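/- Let M, N ≥ 1 be integers, let φ : [1,∞) → (0,1] be non-increasing, let L ∈ ℝ^{M×N} be φ-semi multiplicatively badly approximable, and let Q ≥ 1 be a real number. Then Σ_{q ∈ ([−Q,Q]^N ∩ ℤ^N) \ {0}} ∏_{i=1}^M ‖L_i(q)‖^{−1} ≤ Σ_{k=0}^{⌊log₂(Q^N/φ(Q))⌋} 2^{k+1} · #M(L, 2^{−k}, 1/2, Q), where for ε, T > 0, M(L,ε,T,Q) := {(p,q) ∈ ℤ^M × (ℤ^N \ {0}) : ∏_{i=1}^M |L_i(q)+p_i| < ε, |L_i(q)+p_i| ≤ T for all i, and |q_j| ≤ Q for all j}. -/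

import Mathlib

open scoped BigOperators

/-- distance from a real number to the nearest integer -/
noncomputable def distNearestInt (x : ℝ) : ℝ := |x - (round x : ℤ)|

lemma distNearestInt_nonneg (x : ℝ) : 0 ≤ distNearestInt x := abs_nonneg _

lemma distNearestInt_le_half (x : ℝ) : distNearestInt x ≤ 1 / 2 := abs_sub_round x

lemma abs_add_neg_round (x : ℝ) : |x + ((-round x : ℤ) : ℝ)| = distNearestInt x := by
  simp [distNearestInt, sub_eq_add_neg]

/-- A real number greater than `1` lies in a half-open dyadic interval
`(2 ^ k, 2 ^ (k + 1)]` with `k` a natural number. -/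
lemma exists_nat_two_pow_lt_le {x : ℝ} (hx : 1 < x) :
    ∃ k : ℕ, (2 : ℝ) ^ k < x ∧ x ≤ (2 : ℝ) ^ (k + 1) := by
  obtain ⟨n, hn1, hn2⟩ := exists_mem_Ioc_zpow (zero_lt_one.trans hx) (one_lt_two (α := ℝ))
  have hn : 0 < n + 1 := (one_lt_zpow_iff_right₀ (one_lt_two (α := ℝ))).1 (hx.trans_le hn2)
  lift n to ℕ using by lia
  exact ⟨n, by exact_mod_cast hn1, by exact_mod_cast hn2⟩

/-- Only finitely many pairs `(p, q)` satisfy `|L q + p| ≤ T` and `|q| ≤ Q`. -/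
lemma finite_setOf_abs_linearForm_add_le {M N : ℕ} (L : Matrix (Fin M) (Fin N) ℝ) (T Q : ℝ) :
    {pq : (Fin M → ℤ) × (Fin N → ℤ) |
      (∀ i, |(∑ j, L i j * (pq.2 j : ℝ)) + (pq.1 i : ℝ)| ≤ T) ∧
      ∀ j, |(pq.2 j : ℝ)| ≤ Q}.Finite := by
  refine (((Set.Finite.pi' fun i : Fin M => Set.finite_Icc (-⌊T + ∑ j, |L i j| * Q⌋)
    ⌊T + ∑ j, |L i j| * Q⌋).prod (Set.Finite.pi' fun _ : Fin N =>
      Set.finite_Icc (-⌊Q⌋) ⌊Q⌋)).subset ?_)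
  rintro ⟨p, q⟩ ⟨hp, hq⟩
  simp only at hp hq
  refine ⟨fun i => abs_le.1 (Int.le_floor.2 ?_), fun j => abs_le.1 (Int.le_floor.2 ?_)⟩
  · have hsum : |∑ j, L i j * (q j : ℝ)| ≤ ∑ j, |L i j| * Q :=
      (Finset.abs_sum_le_sum_abs _ _).trans <| Finset.sum_le_sum fun j _ => by
        rw [abs_mul]
        exact mul_le_mul_of_nonneg_left (hq j) (abs_nonneg _)
    have hi := hp i
    push_cast
    rw [abs_le] at hsum hi ⊢
    constructor <;> linarith
  · push_cast
    exact hq j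

/-- A `φ`-semi multiplicatively badly approximable matrix satisfies
`φ Q / Q ^ N ≤ ∏ ‖L_i q‖` for nonzero `q` of sup norm at most `Q`. -/
lemma div_pow_le_prod_distNearestInt {M N : ℕ} {φ : ℝ → ℝ}
    (hφmono : ∀ x y, 1 ≤ x → x ≤ y → φ y ≤ φ x) {L : Matrix (Fin M) (Fin N) ℝ}
    (hbad : ∀ q : Fin N → ℤ, q ≠ 0 →
      φ ‖(fun j => (q j : ℝ))‖ ≤ ‖(fun j => (q j : ℝ))‖ ^ N *
        ∏ i, distNearestInt (∑ j, L i j * (q j : ℝ)))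
    {Q : ℝ} (hQ : 1 ≤ Q) {q : Fin N → ℤ} (hq : q ≠ 0) (hqQ : ∀ j, |(q j : ℝ)| ≤ Q) :
    φ Q / Q ^ N ≤ ∏ i, distNearestInt (∑ j, L i j * (q j : ℝ)) := by
  have hQ0 : 0 < Q := zero_lt_one.trans_le hQ
  have hnorm : ‖(fun j => (q j : ℝ))‖ ≤ Q := (pi_norm_le_iff_of_nonneg hQ0.le).2 hqQ
  have hone : 1 ≤ ‖(fun j => (q j : ℝ))‖ := by
    obtain ⟨j, hj⟩ := Function.ne_iff.1 hq
    have hj1 : (1 : ℝ) ≤ |(q j : ℝ)| := by exact_mod_cast Int.one_le_abs hj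
    exact hj1.trans (norm_le_pi_norm (fun j => (q j : ℝ)) j)
  rw [div_le_iff₀' (pow_pos hQ0 N)]
  refine (hφmono _ _ hone hnorm).trans ((hbad q hq).trans ?_)
  exact mul_le_mul_of_nonneg_right (pow_le_pow_left₀ (norm_nonneg _) hnorm N)
    (Finset.prod_nonneg fun i _ => distNearestInt_nonneg _)

/-- The reciprocal of `P ∈ (0, 1)` is bounded by the sum of `2 ^ (k + 1)` over those `k` with
`P < 2 ^ (-k)`, and it suffices to take `k ≤ ⌊log₂ B⌋` when `P⁻¹ ≤ B`. -/
lemma inv_le_sum_two_pow {P B : ℝ} (hP0 : 0 < P) (hP1 : P < 1) (hB : P⁻¹ ≤ B) :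
    P⁻¹ ≤ ∑ k ∈ Finset.range (⌊Real.logb 2 B⌋.toNat + 1),
      if P < (2 : ℝ) ^ (-(k : ℤ)) then (2 : ℝ) ^ (k + 1) else 0 := by
  obtain ⟨k, hk1, hk2⟩ := exists_nat_two_pow_lt_le ((one_lt_inv₀ hP0).2 hP1)
  have hkB : (k : ℤ) ≤ ⌊Real.logb 2 B⌋ := by
    rw [Int.le_floor, Int.cast_natCast,
      Real.le_logb_iff_rpow_le one_lt_two ((inv_pos.2 hP0).trans_le hB), Real.rpow_natCast]
    exact hk1.le.trans hB
  have hPk : P < (2 : ℝ) ^ (-(k : ℤ)) := by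
    rw [zpow_neg, zpow_natCast]
    exact (lt_inv_comm₀ (by positivity) hP0).1 hk1
  have hle := Finset.single_le_sum (s := Finset.range (⌊Real.logb 2 B⌋.toNat + 1))
    (f := fun k : ℕ => if P < (2 : ℝ) ^ (-(k : ℤ)) then (2 : ℝ) ^ (k + 1) else 0)
    (fun l _ => by positivity) (Finset.mem_range.2 (by lia : k < _))
  simp only [if_pos hPk] at hle
  exact hk2.trans hle

/-- **Equation (6.1)** (dyadic decomposition): the sum of reciprocals of products of
fractional parts is bounded by the dyadic sum `Σ_k 2^{k+1} #M(L, 2^{-k}, 1/2, Q)` for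
`k` up to `⌊log₂(Q^N/φ(Q))⌋`. -/
theorem dyadic_decomposition_sum (M N : ℕ) (hM : 1 ≤ M) (hN : 1 ≤ N)
    (φ : ℝ → ℝ) (hφ01 : ∀ x, 1 ≤ x → 0 < φ x ∧ φ x ≤ 1)
    (hφmono : ∀ x y, 1 ≤ x → x ≤ y → φ y ≤ φ x)
    (L : Matrix (Fin M) (Fin N) ℝ)
    (hbad : ∀ q : Fin N → ℤ, q ≠ 0 →
      φ ‖(fun j => (q j : ℝ))‖ ≤ ‖(fun j => (q j : ℝ))‖ ^ N *
        ∏ i, distNearestInt (∑ j, L i j * (q j : ℝ)))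
    (Q : ℝ) (hQ : 1 ≤ Q) :
    ∑ q ∈ (Fintype.piFinset fun _ : Fin N => Finset.Icc (-⌊Q⌋) ⌊Q⌋).erase 0,
        ∏ i, (distNearestInt (∑ j, L i j * (q j : ℝ)))⁻¹ ≤
      ∑ k ∈ Finset.range ((⌊Real.logb 2 (Q ^ N / φ Q)⌋).toNat + 1),
        (2 : ℝ) ^ (k + 1) *
          (Set.ncard {pq : (Fin M → ℤ) × (Fin N → ℤ) | pq.2 ≠ 0 ∧
            (∏ i, abs ((∑ j, L i j * (pq.2 j : ℝ)) + (pq.1 i : ℝ))) < (2 : ℝ) ^ (-(k : ℤ)) ∧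
            (∀ i, abs ((∑ j, L i j * (pq.2 j : ℝ)) + (pq.1 i : ℝ)) ≤ 1 / 2) ∧
            (∀ j, abs ((pq.2 j : ℝ)) ≤ Q)} : ℝ) := by
  have hQ0 : 0 < Q := zero_lt_one.trans_le hQ
  have hφQ : 0 < φ Q := (hφ01 Q hQ).1
  set S := (Fintype.piFinset fun _ : Fin N => Finset.Icc (-⌊Q⌋) ⌊Q⌋).erase 0
  have hS : ∀ q ∈ S, q ≠ 0 ∧ ∀ j, |(q j : ℝ)| ≤ Q := by
    intro q hq
    obtain ⟨hq0, hq⟩ := Finset.mem_erase.1 hq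
    refine ⟨hq0, fun j => ?_⟩
    have hj := Int.le_floor.1 (abs_le.2 (Finset.mem_Icc.1 (Fintype.mem_piFinset.1 hq j)))
    exact_mod_cast hj
  let P : (Fin N → ℤ) → ℝ := fun q => ∏ i, distNearestInt (∑ j, L i j * (q j : ℝ))
  have hterm : ∀ q ∈ S, ∏ i, (distNearestInt (∑ j, L i j * (q j : ℝ)))⁻¹ ≤
      ∑ k ∈ Finset.range (⌊Real.logb 2 (Q ^ N / φ Q)⌋.toNat + 1),
        if P q < (2 : ℝ) ^ (-(k : ℤ)) then (2 : ℝ) ^ (k + 1) else 0 := by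
    intro q hq
    have hlow : φ Q / Q ^ N ≤ P q :=
      div_pow_le_prod_distNearestInt hφmono hbad hQ (hS q hq).1 (hS q hq).2
    have hpos : 0 < φ Q / Q ^ N := by positivity
    have hlt : P q < 1 := by
      calc P q ≤ ∏ _i : Fin M, (1 / 2 : ℝ) := Finset.prod_le_prod
            (fun i _ => distNearestInt_nonneg _) fun i _ => distNearestInt_le_half _
        _ = (1 / 2 : ℝ) ^ M := by simp
        _ < 1 := pow_lt_one₀ (by norm_num) (by norm_num) (by lia)
    rw [Finset.prod_inv_distrib]
    refine inv_le_sum_two_pow (hpos.trans_le hlow) hlt ?_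
    rw [← inv_div]
    exact inv_anti₀ hpos hlow
  refine (Finset.sum_le_sum hterm).trans ?_
  rw [Finset.sum_comm]
  refine Finset.sum_le_sum fun k _ => ?_
  rw [← Finset.sum_filter, Finset.sum_const, nsmul_eq_mul, mul_comm]
  refine mul_le_mul_of_nonneg_left (Nat.cast_le.2 ?_) (by positivity)
  rw [← Set.ncard_coe_finset]
  refine Set.ncard_le_ncard_of_injOn
    (fun q => (fun i => -round (∑ j, L i j * (q j : ℝ)), q)) ?_
    (fun q _ q' _ h => congrArg Prod.snd h)
    ((finite_setOf_abs_linearForm_add_le L (1 / 2) Q).subset fun pq h => h.2.2)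
  intro q hq
  obtain ⟨hqS, hqk⟩ := Finset.mem_filter.1 hq
  simp only [Set.mem_ofPred_eq, abs_add_neg_round]
  exact ⟨(hS q hqS).1, hqk, fun i => distNearestInt_le_half _, (hS q hqS).2⟩
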